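/- arXiv:2201.02342 — 3 statements merged into one kernel-verified Lean document; each statement's English description precedes it below -/
import Mathlib

section
/- Assume Moser's inequality hypothesis. Let β > 0, q > 0 and N > 0 satisfy βN² < 2π. Then there exists a constant C = C(β, N, q) > 0 such that for every pair W = (u,v) of smooth functions with compact support contained in Ω satisfying ‖W‖ ≤ N, one has ∫_Ω |W(x)|^q exp(β |W(x)|²) dx ≤ C ‖W‖^q. -/
open MeasureTheory Real Filter

noncomputable def gnorm (Ω : Set (ℝ × ℝ)) (u : (ℝ × ℝ) → ℝ) : ℝ :=
  Real.sqrt (∫ x in Ω, ‖fderiv ℝ u x‖ ^ 2)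

noncomputable def pnorm (Ω : Set (ℝ × ℝ)) (u v : (ℝ × ℝ) → ℝ) : ℝ :=
  Real.sqrt ((gnorm Ω u) ^ 2 + (gnorm Ω v) ^ 2)

def IsTest (Ω : Set (ℝ × ℝ)) (u : (ℝ × ℝ) → ℝ) : Prop :=
  ContDiff ℝ (⊤ : ℕ∞) u ∧ HasCompactSupport u ∧ tsupport u ⊆ Ω

noncomputable def Jfun (Ω : Set (ℝ × ℝ)) (a₁ a₂ b₁ b₂ θ₁ θ₂ lam : ℝ)
    (H : (ℝ × ℝ) → (ℝ × ℝ) → ℝ) (u v : (ℝ × ℝ) → ℝ) : ℝ :=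
  (1/2) * (a₁ * (gnorm Ω u) ^ 2 + (b₁/θ₁) * (gnorm Ω u) ^ (2*θ₁))
  + (1/2) * (a₂ * (gnorm Ω v) ^ 2 + (b₂/θ₂) * (gnorm Ω v) ^ (2*θ₂))
  - lam * ∫ x in Ω, H x (u x, v x)

lemma rpow_le_const_mul_exp {p δ y : ℝ} (hp : 0 < p) (hδ : 0 < δ) (hy : 0 ≤ y) :
    y ^ p ≤ (p / δ) ^ p * Real.exp (δ * y) := by
  have hz : δ * y / p ≤ Real.exp (δ * y / p) := by
    linarith [Real.add_one_le_exp (δ * y / p)]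
  calc y ^ p = (p / δ * (δ * y / p)) ^ p := by congr 1; field_simp
    _ = (p / δ) ^ p * (δ * y / p) ^ p := Real.mul_rpow (by positivity) (by positivity)
    _ ≤ (p / δ) ^ p * Real.exp (δ * y / p) ^ p := by gcongr
    _ = (p / δ) ^ p * Real.exp (δ * y) := by
      rw [← Real.exp_mul]; congr 2; field_simp

lemma IsTest.const_mul {Ω : Set (ℝ × ℝ)} {u : (ℝ × ℝ) → ℝ} (hu : IsTest Ω u) (c : ℝ) :
    IsTest Ω (fun x => c * u x) :=
  ⟨contDiff_const.mul hu.1, hu.2.1.mul_left (f := fun _ => c),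
    (tsupport_mul_subset_right (f := fun _ => c)).trans hu.2.2⟩

lemma gnorm_const_mul {Ω : Set (ℝ × ℝ)} {u : (ℝ × ℝ) → ℝ} (hu : IsTest Ω u) (c : ℝ) :
    gnorm Ω (fun x => c * u x) = |c| * gnorm Ω u := by
  have h (x : ℝ × ℝ) : ‖fderiv ℝ (fun y => c * u y) x‖ ^ 2 = c ^ 2 * ‖fderiv ℝ u x‖ ^ 2 := by
    rw [fderiv_const_mul (hu.1.differentiable (by simp) x), norm_smul, mul_pow,
      Real.norm_eq_abs, sq_abs]
  unfold gnorm
  simp_rw [h]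
  rw [integral_const_mul, Real.sqrt_mul (sq_nonneg c), Real.sqrt_sq_eq_abs]

lemma gnorm_le_pnorm_left (Ω : Set (ℝ × ℝ)) (u v : (ℝ × ℝ) → ℝ) :
    gnorm Ω u ≤ pnorm Ω u v :=
  Real.le_sqrt_of_sq_le (le_add_of_nonneg_right (sq_nonneg _))

lemma gnorm_le_pnorm_right (Ω : Set (ℝ × ℝ)) (u v : (ℝ × ℝ) → ℝ) :
    gnorm Ω v ≤ pnorm Ω u v :=
  Real.le_sqrt_of_sq_le (le_add_of_nonneg_left (sq_nonneg _))

lemma Continuous.integrableOn_of_isBounded {Ω : Set (ℝ × ℝ)} (hbd : Bornology.IsBounded Ω)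
    {f : ℝ × ℝ → ℝ} (hf : Continuous f) : IntegrableOn f Ω :=
  (hf.continuousOn.integrableOn_compact hbd.isCompact_closure).mono_set subset_closure

lemma exp_two_pi_mul_add_le (a b : ℝ) :
    Real.exp (2 * π * (a + b)) ≤ (Real.exp (4 * π * a) + Real.exp (4 * π * b)) / 2 := by
  have ha : Real.exp (4 * π * a) = Real.exp (2 * π * a) ^ 2 := by
    rw [← Real.exp_nat_mul]; congr 1; push_cast; ring
  have hb : Real.exp (4 * π * b) = Real.exp (2 * π * b) ^ 2 := by
    rw [← Real.exp_nat_mul]; congr 1; push_cast; ring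
  rw [mul_add, Real.exp_add, ha, hb]
  linarith [two_mul_le_add_sq (Real.exp (2 * π * a)) (Real.exp (2 * π * b))]

/-- The pointwise bound behind `stmt_2`, for `u` and `v` rescaled by `s`. -/
lemma sqrt_rpow_mul_exp_le {β q N s : ℝ} (hβ : 0 < β) (hq : 0 < q)
    (hβN : β * N ^ 2 < 2 * π) (hs : 0 < s) (hsN : s ≤ N) (a b : ℝ) :
    Real.sqrt (a ^ 2 + b ^ 2) ^ q * Real.exp (β * (a ^ 2 + b ^ 2)) ≤
      s ^ q * (q / 2 / (2 * π - β * N ^ 2)) ^ (q / 2) *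
        ((Real.exp (4 * π * (s⁻¹ * a) ^ 2) + Real.exp (4 * π * (s⁻¹ * b) ^ 2)) / 2) := by
  set y := (s⁻¹ * a) ^ 2 + (s⁻¹ * b) ^ 2 with hy
  have hy0 : 0 ≤ y := by positivity
  have hab : a ^ 2 + b ^ 2 = s ^ 2 * y := by rw [hy]; field_simp
  have hδ : 0 < 2 * π - β * N ^ 2 := sub_pos.2 hβN
  have hsqrt : Real.sqrt (s ^ 2 * y) ^ q = s ^ q * y ^ (q / 2) := by
    rw [Real.sqrt_mul (sq_nonneg s), Real.sqrt_sq hs.le, Real.mul_rpow hs.le (Real.sqrt_nonneg _),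
      Real.sqrt_eq_rpow, ← Real.rpow_mul hy0]
    congr 2; ring
  have hsN2 : β * (s ^ 2 * y) ≤ β * N ^ 2 * y := by
    rw [← mul_assoc]; gcongr
  rw [hab, hsqrt]
  calc s ^ q * y ^ (q / 2) * Real.exp (β * (s ^ 2 * y))
      ≤ s ^ q * ((q / 2 / (2 * π - β * N ^ 2)) ^ (q / 2) *
          Real.exp ((2 * π - β * N ^ 2) * y)) * Real.exp (β * N ^ 2 * y) := by
        gcongr
        exact rpow_le_const_mul_exp (half_pos hq) hδ hy0
    _ = s ^ q * (q / 2 / (2 * π - β * N ^ 2)) ^ (q / 2) * Real.exp (2 * π * y) := by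
        rw [mul_assoc, mul_assoc _ (Real.exp _), ← Real.exp_add, ← mul_assoc]
        congr 2; ring
    _ ≤ _ := by
        gcongr
        exact exp_two_pi_mul_add_le _ _

/-- Assuming Moser's inequality, for `β, q, N > 0` with `βN² < 2π` there is `C > 0`
such that every pair `W = (u,v)` of smooth compactly supported functions in `Ω`
with `‖W‖ ≤ N` satisfies `∫_Ω |W|^q exp(β|W|²) ≤ C ‖W‖^q`. -/
theorem stmt_2 (Ω : Set (ℝ × ℝ)) (hne : Ω.Nonempty) (hop : IsOpen Ω)
    (hbd : Bornology.IsBounded Ω)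
    (CΩ : ℝ) (hCΩ : 0 < CΩ)
    (moser : ∀ u : (ℝ × ℝ) → ℝ, IsTest Ω u → gnorm Ω u ≤ 1 →
      ∫ x in Ω, Real.exp (4 * Real.pi * (u x) ^ 2) ≤ CΩ)
    (β q N : ℝ) (hβ : 0 < β) (hq : 0 < q) (hN : 0 < N)
    (hβN : β * N ^ 2 < 2 * Real.pi) :
    ∃ C > 0, ∀ u v : (ℝ × ℝ) → ℝ, IsTest Ω u → IsTest Ω v →
      pnorm Ω u v ≤ N →
      ∫ x in Ω, (Real.sqrt ((u x) ^ 2 + (v x) ^ 2)) ^ q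
          * Real.exp (β * ((u x) ^ 2 + (v x) ^ 2))
        ≤ C * (pnorm Ω u v) ^ q := by
  set K := (q / 2 / (2 * π - β * N ^ 2)) ^ (q / 2)
  have hδ : 0 < 2 * π - β * N ^ 2 := sub_pos.2 hβN
  have hK : 0 < K := by positivity
  have bound (u v : (ℝ × ℝ) → ℝ) (hu : IsTest Ω u) (hv : IsTest Ω v) (s : ℝ) (hs : 0 < s)
      (hsN : s ≤ N) (huv : pnorm Ω u v ≤ s) :
      ∫ x in Ω, (Real.sqrt ((u x) ^ 2 + (v x) ^ 2)) ^ q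
          * Real.exp (β * ((u x) ^ 2 + (v x) ^ 2)) ≤ K * CΩ * s ^ q := by
    have scaled (w : (ℝ × ℝ) → ℝ) (hw : IsTest Ω w) (hws : gnorm Ω w ≤ s) :
        IntegrableOn (fun x => Real.exp (4 * π * (s⁻¹ * w x) ^ 2)) Ω ∧
        ∫ x in Ω, Real.exp (4 * π * (s⁻¹ * w x) ^ 2) ≤ CΩ := by
      refine ⟨Continuous.integrableOn_of_isBounded hbd ?_,
        moser _ (hw.const_mul s⁻¹) ?_⟩
      · have := hw.1.continuous
        fun_prop
      · rw [gnorm_const_mul hw, abs_of_pos (inv_pos.2 hs), inv_mul_le_iff₀ hs, mul_one]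
        exact hws
    obtain ⟨hui, hule⟩ := scaled u hu ((gnorm_le_pnorm_left Ω u v).trans huv)
    obtain ⟨hvi, hvle⟩ := scaled v hv ((gnorm_le_pnorm_right Ω u v).trans huv)
    calc _ ≤ ∫ x in Ω, s ^ q * K * ((Real.exp (4 * π * (s⁻¹ * u x) ^ 2)
            + Real.exp (4 * π * (s⁻¹ * v x) ^ 2)) / 2) :=
          integral_mono_of_nonneg (.of_forall fun x => by positivity)
            (((hui.add hvi).div_const 2).const_mul _)
            (.of_forall fun x => sqrt_rpow_mul_exp_le hβ hq hβN hs hsN _ _)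
      _ = s ^ q * K * ((∫ x in Ω, Real.exp (4 * π * (s⁻¹ * u x) ^ 2))
            + ∫ x in Ω, Real.exp (4 * π * (s⁻¹ * v x) ^ 2)) / 2 := by
          rw [integral_const_mul, integral_div, integral_add hui hvi, mul_div_assoc]
      _ ≤ s ^ q * K * (CΩ + CΩ) / 2 := by gcongr
      _ = K * CΩ * s ^ q := by ring
  refine ⟨K * CΩ, by positivity, fun u v hu hv huv => ?_⟩
  have hnn : 0 ≤ pnorm Ω u v := Real.sqrt_nonneg _
  rcases hnn.eq_or_lt with h0 | hpos
  · rw [← h0]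
    have hlim : Tendsto (fun s : ℝ => K * CΩ * s ^ q) (nhdsWithin 0 (Set.Ioi 0))
        (nhds (K * CΩ * 0 ^ q)) :=
      ((Real.continuousAt_rpow_const 0 q (Or.inr hq.le)).tendsto.const_mul _).mono_left
        nhdsWithin_le_nhds
    refine ge_of_tendsto hlim ?_
    filter_upwards [Ioc_mem_nhdsGT hN] with s hs
    exact bound u v hu hv s hs.1 hs.2 (h0 ▸ hs.1.le)
  · exact bound u v hu hv _ hpos huv le_rfl
end

section
/- Assume H is continuous on closure(Ω) × ℝ², C¹ in W with jointly continuous gradient, and satisfies (H₁): H(x,W) ≥ 0, u H_u(x,W) ≥ 0 and v H_v(x,W) ≥ 0 for all x ∈ closure(Ω) and W = (u,v) ∈ ℝ²; and (H̄₂): there exist μ ≥ 2θ_max and R > 0 such that 0 < μ H(x,W) ≤ W·∇H(x,W) whenever x ∈ closure(Ω) and |W| ≥ R. Let c ∈ ℝ, let ε_n → 0 be a sequence of nonnegative reals, and let W_n = (u_n, v_n) be a sequence of pairs of smooth functions with compact support in Ω such that J_λ(W_n) → c and |a₁‖u_n‖² + b₁‖u_n‖^{2θ₁} + a₂‖v_n‖²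 + b₂‖v_n‖^{2θ₂} − λ ∫_Ω (u_n H_u(x,W_n) + v_n H_v(x,W_n)) dx| ≤ ε_n ‖W_n‖ for all n. Then there exists C > 0 such that ‖W_n‖ ≤ C, ∫_Ω u_n H_u(x,W_n) dx ≤ C and ∫_Ω v_n H_v(x,W_n) dx ≤ C for all n. -/
open MeasureTheory Real Filter

lemma le_of_mul_sq_le_add_mul {A B D p : ℝ} (hA : 0 < A) (hB : 0 ≤ B) (hD : 0 ≤ D)
    (h : A * p ^ 2 ≤ B + D * p) : p ≤ (B + D) / A + 1 := by
  rcases le_total p 1 with hp | hp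
  · have : 0 ≤ (B + D) / A := by positivity
    linarith
  · have : p ≤ (B + D) / A := by
      rw [le_div_iff₀ hA]
      nlinarith [mul_le_mul_of_nonneg_left hp hB]
    linarith

lemma pnorm_sq (Ω : Set (ℝ × ℝ)) (u v : (ℝ × ℝ) → ℝ) :
    pnorm Ω u v ^ 2 = gnorm Ω u ^ 2 + gnorm Ω v ^ 2 :=
  Real.sq_sqrt (by positivity)

/-- A Carathéodory-type composition is integrable on a bounded set when everything is continuous
up to the boundary. -/
lemma integrableOn_comp_of_isBounded {Ω : Set (ℝ × ℝ)} (hbd : Bornology.IsBounded Ω)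
    {F : (ℝ × ℝ) → (ℝ × ℝ) → ℝ}
    (hF : ContinuousOn (fun p : (ℝ × ℝ) × (ℝ × ℝ) => F p.1 p.2) (closure Ω ×ˢ Set.univ))
    {u v : (ℝ × ℝ) → ℝ} (hu : Continuous u) (hv : Continuous v) :
    IntegrableOn (fun x => F x (u x, v x)) Ω := by
  have hc : ContinuousOn (fun x => F x (u x, v x)) (closure Ω) :=
    hF.comp (f := fun x => (x, (u x, v x))) (by fun_prop) fun x hx => ⟨hx, Set.mem_univ _⟩
  exact (hc.integrableOn_compact hbd.isCompact_closure).mono_set subset_closure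

/-- The Ambrosetti–Rabinowitz inequality at infinity holds everywhere up to a constant. -/
lemma exists_mul_le_add_of_superquadratic {Ω : Set (ℝ × ℝ)} (hbd : Bornology.IsBounded Ω)
    {H G : (ℝ × ℝ) → (ℝ × ℝ) → ℝ} {μ R : ℝ}
    (hHc : ContinuousOn (fun p : (ℝ × ℝ) × (ℝ × ℝ) => H p.1 p.2) (closure Ω ×ˢ Set.univ))
    (hG : ∀ x ∈ closure Ω, ∀ W, 0 ≤ G x W)
    (hHG : ∀ x ∈ closure Ω, ∀ W : ℝ × ℝ, R ≤ Real.sqrt (W.1 ^ 2 + W.2 ^ 2) →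
      μ * H x W ≤ G x W) :
    ∃ K, 0 ≤ K ∧ ∀ x ∈ closure Ω, ∀ W, μ * H x W ≤ G x W + K := by
  have hK : IsCompact (closure Ω ×ˢ Metric.closedBall (0 : ℝ × ℝ) R) :=
    hbd.isCompact_closure.prod (isCompact_closedBall _ _)
  obtain ⟨K, hK⟩ := hK.exists_bound_of_continuousOn
    ((hHc.const_mul μ).mono (Set.prod_mono_right (Set.subset_univ _)))
  refine ⟨max K 0, le_max_right _ _, fun x hx W => ?_⟩
  rcases le_or_gt R (Real.sqrt (W.1 ^ 2 + W.2 ^ 2)) with hW | hW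
  · linarith [hHG x hx W hW, le_max_right K 0]
  · have hW' : W ∈ Metric.closedBall (0 : ℝ × ℝ) R := by
      rw [mem_closedBall_zero_iff, Prod.norm_def]
      refine max_le ?_ ?_
      · exact (Real.abs_le_sqrt (by nlinarith [sq_nonneg W.2])).trans hW.le
      · exact (Real.abs_le_sqrt (by nlinarith [sq_nonneg W.1])).trans hW.le
    have h := (le_abs_self _).trans (hK (x, W) ⟨hx, hW'⟩)
    simp only at h
    linarith [hG x hx W, le_max_left K 0]

/-- Boundedness of Palais–Smale sequences: under `(H₁)` and `(H̄₂)`, any sequence `Wₙ`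
with `J_λ(Wₙ) → c` and the almost-critical-point estimate is bounded, together with the
nonlinear integral terms. -/
theorem stmt_6 (Ω : Set (ℝ × ℝ)) (hne : Ω.Nonempty) (hop : IsOpen Ω)
    (hbd : Bornology.IsBounded Ω)
    (a₁ a₂ b₁ b₂ θ₁ θ₂ lam : ℝ)
    (ha₁ : 0 < a₁) (ha₂ : 0 < a₂) (hb₁ : 0 < b₁) (hb₂ : 0 < b₂)
    (hθ₁ : 1 < θ₁) (hθ₂ : 1 < θ₂) (hlam : 0 < lam)
    (H Hu Hv : (ℝ × ℝ) → (ℝ × ℝ) → ℝ)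
    (hHc : ContinuousOn (fun p : (ℝ × ℝ) × (ℝ × ℝ) => H p.1 p.2) (closure Ω ×ˢ Set.univ))
    (hgradc : ContinuousOn (fun p : (ℝ × ℝ) × (ℝ × ℝ) => (Hu p.1 p.2, Hv p.1 p.2))
      (closure Ω ×ˢ Set.univ))
    (hderiv : ∀ x ∈ closure Ω, ∀ W : ℝ × ℝ,
      HasFDerivAt (H x)
        ((Hu x W) • ContinuousLinearMap.fst ℝ ℝ ℝ + (Hv x W) • ContinuousLinearMap.snd ℝ ℝ ℝ) W)
    -- (H₁)
    (hH1 : ∀ x ∈ closure Ω, ∀ W : ℝ × ℝ,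
      0 ≤ H x W ∧ 0 ≤ W.1 * Hu x W ∧ 0 ≤ W.2 * Hv x W)
    -- (H̄₂)
    (μ R : ℝ) (hμ : 2 * max θ₁ θ₂ ≤ μ) (hR : 0 < R)
    (hH2bar : ∀ x ∈ closure Ω, ∀ W : ℝ × ℝ, R ≤ Real.sqrt (W.1 ^ 2 + W.2 ^ 2) →
      0 < μ * H x W ∧ μ * H x W ≤ W.1 * Hu x W + W.2 * Hv x W)
    (c : ℝ) (ε : ℕ → ℝ) (hε0 : ∀ n, 0 ≤ ε n) (hε : Tendsto ε atTop (nhds 0))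
    (u v : ℕ → (ℝ × ℝ) → ℝ) (hu : ∀ n, IsTest Ω (u n)) (hv : ∀ n, IsTest Ω (v n))
    (hJ : Tendsto (fun n => Jfun Ω a₁ a₂ b₁ b₂ θ₁ θ₂ lam H (u n) (v n)) atTop (nhds c))
    (hPS : ∀ n,
      |a₁ * (gnorm Ω (u n)) ^ 2 + b₁ * (gnorm Ω (u n)) ^ (2 * θ₁)
        + a₂ * (gnorm Ω (v n)) ^ 2 + b₂ * (gnorm Ω (v n)) ^ (2 * θ₂)
        - lam * ∫ x in Ω, (u n x * Hu x (u n x, v n x) + v n x * Hv x (u n x, v n x))|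
      ≤ ε n * pnorm Ω (u n) (v n)) :
    ∃ C > 0, ∀ n,
      pnorm Ω (u n) (v n) ≤ C ∧
      (∫ x in Ω, u n x * Hu x (u n x, v n x)) ≤ C ∧
      (∫ x in Ω, v n x * Hv x (u n x, v n x)) ≤ C := by
  have hθ₁μ : 2 * θ₁ ≤ μ := le_trans (by linarith [le_max_left θ₁ θ₂]) hμ
  have hθ₂μ : 2 * θ₂ ≤ μ := le_trans (by linarith [le_max_right θ₁ θ₂]) hμ
  have hμ2 : 2 < μ := by linarith
  obtain ⟨K, hK0, hK⟩ := exists_mul_le_add_of_superquadratic (μ := μ) (R := R)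
    (G := fun x W => W.1 * Hu x W + W.2 * Hv x W) hbd hHc
    (fun x hx W => add_nonneg (hH1 x hx W).2.1 (hH1 x hx W).2.2)
    (fun x hx W hW => (hH2bar x hx W hW).2)
  obtain ⟨c', hc'⟩ := hJ.bddAbove_range
  obtain ⟨e, he⟩ := hε.bddAbove_range
  have hJle : ∀ n, Jfun Ω a₁ a₂ b₁ b₂ θ₁ θ₂ lam H (u n) (v n) ≤ |c'| := fun n =>
    (hc' ⟨n, rfl⟩).trans (le_abs_self _)
  have hεe : ∀ n, ε n ≤ e := fun n => he ⟨n, rfl⟩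
  have he0 : 0 ≤ e := (hε0 0).trans (hεe 0)
  have hvol : volume Ω ≠ ⊤ := hbd.measure_lt_top.ne
  have hIH : ∀ n, IntegrableOn (fun x => H x (u n x, v n x)) Ω := fun n =>
    integrableOn_comp_of_isBounded hbd hHc (hu n).1.continuous (hv n).1.continuous
  have hIu : ∀ n, IntegrableOn (fun x => u n x * Hu x (u n x, v n x)) Ω := fun n =>
    integrableOn_comp_of_isBounded (F := fun x W => W.1 * Hu x W) hbd
      ((by fun_prop : Continuous fun p : (ℝ × ℝ) × (ℝ × ℝ) => p.2.1).continuousOn.mul hgradc.fst)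
      (hu n).1.continuous (hv n).1.continuous
  have hIv : ∀ n, IntegrableOn (fun x => v n x * Hv x (u n x, v n x)) Ω := fun n =>
    integrableOn_comp_of_isBounded (F := fun x W => W.2 * Hv x W) hbd
      ((by fun_prop : Continuous fun p : (ℝ × ℝ) × (ℝ × ℝ) => p.2.2).continuousOn.mul hgradc.snd)
      (hu n).1.continuous (hv n).1.continuous
  set V : ℝ := volume.real Ω
  have hV0 : 0 ≤ V := measureReal_nonneg
  have hint : ∀ n, μ * ∫ x in Ω, H x (u n x, v n x) ≤
      (∫ x in Ω, (u n x * Hu x (u n x, v n x) + v n x * Hv x (u n x, v n x))) + K * V := by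
    intro n
    have hIK : IntegrableOn (fun _ : ℝ × ℝ => K) Ω := integrableOn_const hvol
    have hIG : IntegrableOn
        (fun x => u n x * Hu x (u n x, v n x) + v n x * Hv x (u n x, v n x)) Ω :=
      (hIu n).add (hIv n)
    calc μ * ∫ x in Ω, H x (u n x, v n x)
        = ∫ x in Ω, μ * H x (u n x, v n x) := (integral_const_mul _ _).symm
      _ ≤ ∫ x in Ω, (u n x * Hu x (u n x, v n x) + v n x * Hv x (u n x, v n x) + K) :=
        setIntegral_mono_on ((hIH n).const_mul μ) (hIG.add hIK) hop.measurableSet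
          fun x hx => hK x (subset_closure hx) (u n x, v n x)
      _ = _ := by
        rw [integral_add hIG hIK, setIntegral_const, smul_eq_mul, mul_comm K V]
  have hp0 : ∀ n, 0 ≤ pnorm Ω (u n) (v n) := fun n => Real.sqrt_nonneg _
  have hg0 : ∀ w, 0 ≤ gnorm Ω w := fun w => Real.sqrt_nonneg _
  set m : ℝ := min a₁ a₂
  have hm : 0 < m := lt_min ha₁ ha₂
  -- `2 μ J - 2 ⟨J', W⟩` controls the square of the norm.
  have hcoer : ∀ n, (μ - 2) * m * pnorm Ω (u n) (v n) ^ 2 ≤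
      (2 * μ * |c'| + 2 * lam * (K * V)) + (2 * e) * pnorm Ω (u n) (v n) := by
    intro n
    have hps := (abs_le.1 (hPS n)).1
    have hep := mul_le_mul_of_nonneg_right (hεe n) (hp0 n)
    have hj := mul_le_mul_of_nonneg_left (hJle n) (by linarith : 0 ≤ 2 * μ)
    have hi := mul_le_mul_of_nonneg_left (hint n) (by linarith : 0 ≤ 2 * lam)
    have hpow : ∀ {b θ t : ℝ}, 0 < b → 1 < θ → 2 * θ ≤ μ → 0 ≤ t →
        2 * (b * t) ≤ μ * (b / θ * t) := by
      intro b θ t hb hθ hθμ ht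
      have hθ0 : 0 < θ := by linarith
      calc 2 * (b * t) = (2 * θ) * (b / θ * t) := by field_simp
        _ ≤ μ * (b / θ * t) := mul_le_mul_of_nonneg_right hθμ (by positivity)
    have h₁ := hpow hb₁ hθ₁ hθ₁μ (Real.rpow_nonneg (hg0 (u n)) (2 * θ₁))
    have h₂ := hpow hb₂ hθ₂ hθ₂μ (Real.rpow_nonneg (hg0 (v n)) (2 * θ₂))
    have hmu : (μ - 2) * (m * gnorm Ω (u n) ^ 2) ≤ (μ - 2) * (a₁ * gnorm Ω (u n) ^ 2) :=
      mul_le_mul_of_nonneg_left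
      (mul_le_mul_of_nonneg_right (min_le_left a₁ a₂) (sq_nonneg (gnorm Ω (u n))))
      (by linarith : 0 ≤ μ - 2)
    have hmv : (μ - 2) * (m * gnorm Ω (v n) ^ 2) ≤ (μ - 2) * (a₂ * gnorm Ω (v n) ^ 2) :=
      mul_le_mul_of_nonneg_left
      (mul_le_mul_of_nonneg_right (min_le_right a₁ a₂) (sq_nonneg (gnorm Ω (v n))))
      (by linarith : 0 ≤ μ - 2)
    rw [pnorm_sq]
    unfold Jfun at hj
    linarith
  have hbound := fun n => le_of_mul_sq_le_add_mul (mul_pos (by linarith) hm)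
    (by positivity) (by positivity) (hcoer n)
  set P : ℝ := (2 * μ * |c'| + 2 * lam * (K * V) + 2 * e) / ((μ - 2) * m) + 1
  have hP0 : 0 ≤ P := (hp0 0).trans (hbound 0)
  have hgu : ∀ n, gnorm Ω (u n) ≤ P := fun n =>
    (Real.le_sqrt_of_sq_le (by linarith [sq_nonneg (gnorm Ω (v n))])).trans (hbound n)
  have hgv : ∀ n, gnorm Ω (v n) ≤ P := fun n =>
    (Real.le_sqrt_of_sq_le (by linarith [sq_nonneg (gnorm Ω (u n))])).trans (hbound n)
  set Q : ℝ := a₁ * P ^ 2 + b₁ * P ^ (2 * θ₁) + a₂ * P ^ 2 + b₂ * P ^ (2 * θ₂) + e * P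
  have hQ0 : 0 ≤ Q := by positivity
  have hQ : ∀ n, (∫ x in Ω, u n x * Hu x (u n x, v n x)) +
      (∫ x in Ω, v n x * Hv x (u n x, v n x)) ≤ Q / lam := by
    intro n
    rw [← integral_add (hIu n) (hIv n), le_div_iff₀ hlam, mul_comm]
    have hps := (abs_le.1 (hPS n)).1
    have hep : ε n * pnorm Ω (u n) (v n) ≤ e * P :=
      mul_le_mul (hεe n) (hbound n) (hp0 n) he0
    have hu2 : a₁ * gnorm Ω (u n) ^ 2 ≤ a₁ * P ^ 2 := by gcongr; exacts [hg0 _, hgu n]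
    have hv2 : a₂ * gnorm Ω (v n) ^ 2 ≤ a₂ * P ^ 2 := by gcongr; exacts [hg0 _, hgv n]
    have huθ : b₁ * gnorm Ω (u n) ^ (2 * θ₁) ≤ b₁ * P ^ (2 * θ₁) :=
      mul_le_mul_of_nonneg_left (Real.rpow_le_rpow (hg0 _) (hgu n) (by linarith)) hb₁.le
    have hvθ : b₂ * gnorm Ω (v n) ^ (2 * θ₂) ≤ b₂ * P ^ (2 * θ₂) :=
      mul_le_mul_of_nonneg_left (Real.rpow_le_rpow (hg0 _) (hgv n) (by linarith)) hb₂.le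
    linarith
  have hQl : 0 ≤ Q / lam := by positivity
  refine ⟨P + Q / lam + 1, by positivity, fun n => ⟨by linarith [hbound n], ?_, ?_⟩⟩
  · have h : 0 ≤ ∫ x in Ω, v n x * Hv x (u n x, v n x) :=
      setIntegral_nonneg hop.measurableSet fun x hx =>
        (hH1 x (subset_closure hx) (u n x, v n x)).2.2
    linarith [hQ n]
  · have h : 0 ≤ ∫ x in Ω, u n x * Hu x (u n x, v n x) :=
      setIntegral_nonneg hop.measurableSet fun x hx =>
        (hH1 x (subset_closure hx) (u n x, v n x)).2.1
    linarith [hQ n]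
end

section
/- Assume Moser's inequality hypothesis and the Poincaré hypothesis: there exists λ₁ > 0 such that λ₁ ∫_Ω (u² + v²) dx ≤ ‖(u,v)‖² for all pairs (u,v) of smooth functions with compact support in Ω. Suppose H : closure(Ω) × ℝ² → ℝ is continuous, H ≥ 0, and satisfies: (SL) for every δ > 0 there exists r > 0 such that H(x,W) ≤ δ |W|² whenever x ∈ closure(Ω) and |W| < r; and the growth condition: there exist β > 0, q > 2 and C₀ > 0 with H(x,W) ≤ C₀ |W|^q exp(β |W|²) for all x ∈ closure(Ω) and |W| ≥ 1. Then for each λ > 0 there exist ρ₀ > 0 and τ₀ > 0 such that J_λ(W) ≥ τ₀ for every pair W of smooth functions with compact support in Ω satisfying ‖W‖ = ρ₀. -/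
open MeasureTheory Real Filter

/-- Near the origin `H` is quadratic with small constant, and globally it is controlled by
`s ^ 2 * exp (γ * s)` with `s = |W| ^ 2`. -/
lemma exists_le_quadratic_add_exp {K : Set (ℝ × ℝ)} (hK : IsCompact K)
    {H : (ℝ × ℝ) → (ℝ × ℝ) → ℝ}
    (hHc : ContinuousOn (fun p : (ℝ × ℝ) × (ℝ × ℝ) => H p.1 p.2) (K ×ˢ Set.univ))
    {δ r : ℝ} (hδ : 0 ≤ δ) (hr : 0 < r)
    (hsmall : ∀ x ∈ K, ∀ W : ℝ × ℝ,
      √(W.1 ^ 2 + W.2 ^ 2) < r → H x W ≤ δ * (W.1 ^ 2 + W.2 ^ 2))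
    {β q C₀ : ℝ} (hβ : 0 < β) (hC₀ : 0 < C₀)
    (hgrowth : ∀ x ∈ K, ∀ W : ℝ × ℝ, 1 ≤ √(W.1 ^ 2 + W.2 ^ 2) →
      H x W ≤ C₀ * √(W.1 ^ 2 + W.2 ^ 2) ^ q * exp (β * (W.1 ^ 2 + W.2 ^ 2))) :
    ∃ C > 0, ∀ x ∈ K, ∀ W : ℝ × ℝ,
      H x W ≤ δ * (W.1 ^ 2 + W.2 ^ 2)
        + C * ((W.1 ^ 2 + W.2 ^ 2) ^ 2 * exp ((β + 1) * (W.1 ^ 2 + W.2 ^ 2))) := by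
  obtain ⟨M, hM⟩ := (hK.prod (isCompact_Icc (a := ((-1, -1) : ℝ × ℝ)) (b := (1, 1))))
    |>.exists_bound_of_continuousOn (hHc.mono (Set.prod_mono_right (Set.subset_univ _)))
  obtain ⟨n, hn⟩ := exists_nat_ge q
  refine ⟨C₀ * n.factorial + |M| / r ^ 4, by positivity, fun x hx W => ?_⟩
  set s := W.1 ^ 2 + W.2 ^ 2 with hs
  have hs0 : 0 ≤ s := by positivity
  have hsq : √s ^ 2 = s := sq_sqrt hs0
  have hexp : 1 ≤ exp ((β + 1) * s) := one_le_exp (by positivity)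
  rcases lt_or_ge (√s) r with h | h
  · have := hsmall x hx W h
    have h2 : 0 ≤ (C₀ * n.factorial + |M| / r ^ 4) * (s ^ 2 * exp ((β + 1) * s)) := by positivity
    linarith
  refine le_trans ?_ (le_add_of_nonneg_left (by positivity))
  rw [add_mul]
  rcases le_or_gt 1 (√s) with h1 | h1
  · refine le_trans ?_ (le_add_of_nonneg_right (by positivity))
    refine (hgrowth x hx W h1).trans ?_
    have hs1 : √s ≤ s := by nlinarith
    have hpow : √s ^ q ≤ n.factorial * exp s := by
      calc √s ^ q ≤ √s ^ (n : ℝ) := rpow_le_rpow_of_exponent_le h1 hn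
        _ = √s ^ n := rpow_natCast _ _
        _ ≤ n.factorial * exp (√s) := by
          have := pow_div_factorial_le_exp (√s) (by positivity) n
          rwa [div_le_iff₀' (by positivity)] at this
        _ ≤ n.factorial * exp s := by gcongr
    have hsplit : exp ((β + 1) * s) = exp s * exp (β * s) := by
      rw [← exp_add]; ring_nf
    calc C₀ * √s ^ q * exp (β * s)
        ≤ C₀ * (n.factorial * exp s) * exp (β * s) := by gcongr
      _ = C₀ * n.factorial * (1 * exp ((β + 1) * s)) := by rw [hsplit]; ring
      _ ≤ C₀ * n.factorial * (s ^ 2 * exp ((β + 1) * s)) := by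
        gcongr
        exact one_le_pow₀ (h1.trans hs1)
  · refine le_trans ?_ (le_add_of_nonneg_left (by positivity))
    have hlt : s < 1 := by nlinarith [sqrt_nonneg s]
    have hW : W ∈ Set.Icc ((-1, -1) : ℝ × ℝ) (1, 1) := by
      have h1 := abs_le.1 (abs_le_one_iff_mul_self_le_one.2
        (show W.1 * W.1 ≤ 1 by nlinarith [sq_nonneg W.2]))
      have h2 := abs_le.1 (abs_le_one_iff_mul_self_le_one.2
        (show W.2 * W.2 ≤ 1 by nlinarith [sq_nonneg W.1]))
      exact ⟨⟨h1.1, h2.1⟩, ⟨h1.2, h2.2⟩⟩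
    have hrs : r ^ 4 ≤ s ^ 2 := by
      rw [← hsq, ← pow_mul]
      gcongr
    calc H x W ≤ |M| := (le_abs_self _).trans ((hM (x, W) ⟨hx, hW⟩).trans (le_abs_self M))
      _ = |M| / r ^ 4 * (r ^ 4 * 1) := by field_simp
      _ ≤ |M| / r ^ 4 * (s ^ 2 * exp ((β + 1) * s)) := by gcongr

lemma gnorm_nonneg (Ω : Set (ℝ × ℝ)) (u : (ℝ × ℝ) → ℝ) : 0 ≤ gnorm Ω u := sqrt_nonneg _

lemma gnorm_const_smul (Ω : Set (ℝ × ℝ)) (c : ℝ) {u : (ℝ × ℝ) → ℝ}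
    (hu : Differentiable ℝ u) : gnorm Ω (c • u) = |c| * gnorm Ω u := by
  have h : ∀ x, ‖fderiv ℝ (c • u) x‖ ^ 2 = c ^ 2 * ‖fderiv ℝ u x‖ ^ 2 := fun x => by
    rw [fderiv_const_smul (hu x), norm_smul, mul_pow, norm_eq_abs, sq_abs]
  simp only [gnorm, h]
  rw [integral_const_mul, sqrt_mul (sq_nonneg c), sqrt_sq_eq_abs]

lemma IsTest.const_smul {Ω : Set (ℝ × ℝ)} {u : (ℝ × ℝ) → ℝ} (hu : IsTest Ω u) (c : ℝ) :
    IsTest Ω (c • u) :=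
  ⟨contDiff_const.smul hu.1, hu.2.1.smul_left (f := fun _ => c),
    (closure_mono (Function.support_const_smul_subset c u)).trans hu.2.2⟩

/-- Rescaled form of Moser's inequality. -/
lemma integral_exp_div_le {Ω : Set (ℝ × ℝ)} {CΩ : ℝ}
    (moser : ∀ u : (ℝ × ℝ) → ℝ, IsTest Ω u → gnorm Ω u ≤ 1 →
      ∫ x in Ω, exp (4 * π * (u x) ^ 2) ≤ CΩ)
    {u : (ℝ × ℝ) → ℝ} (hu : IsTest Ω u) {ρ : ℝ} (hρ : 0 < ρ) (hle : gnorm Ω u ≤ ρ) :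
    ∫ x in Ω, exp (4 * π * (u x / ρ) ^ 2) ≤ CΩ := by
  have h := moser (ρ⁻¹ • u) (hu.const_smul _) (by
    rw [gnorm_const_smul Ω _ (hu.1.differentiable (by simp)), abs_of_pos (by positivity),
      inv_mul_le_iff₀ hρ]
    simpa using hle)
  simpa [div_eq_inv_mul] using h

lemma sq_mul_exp_le {γ ρ a b : ℝ} (hρ : 0 < ρ) (hγρ : γ * ρ ^ 2 ≤ 1) :
    (a ^ 2 + b ^ 2) ^ 2 * exp (γ * (a ^ 2 + b ^ 2)) ≤
      ρ ^ 4 * (exp (4 * π * (a / ρ) ^ 2) + exp (4 * π * (b / ρ) ^ 2)) := by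
  obtain ⟨A, rfl⟩ : ∃ A, a = ρ * A := ⟨a / ρ, by field_simp⟩
  obtain ⟨B, rfl⟩ : ∃ B, b = ρ * B := ⟨b / ρ, by field_simp⟩
  rw [mul_div_cancel_left₀ _ hρ.ne', mul_div_cancel_left₀ _ hρ.ne']
  have hS : 0 ≤ A ^ 2 + B ^ 2 := by positivity
  have h1 : (A ^ 2 + B ^ 2) ^ 2 ≤ 2 * exp (A ^ 2 + B ^ 2) := by
    have := pow_div_factorial_le_exp (A ^ 2 + B ^ 2) hS 2
    norm_num at this
    linarith
  have h2 : exp (γ * ((ρ * A) ^ 2 + (ρ * B) ^ 2)) ≤ exp (A ^ 2 + B ^ 2) := by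
    apply exp_le_exp.2
    nlinarith
  have h3 : ∀ t : ℝ, exp (2 * t ^ 2) ^ 2 ≤ exp (4 * π * t ^ 2) := fun t => by
    rw [← exp_nat_mul]
    apply exp_le_exp.2
    push_cast
    nlinarith [pi_gt_three, sq_nonneg t]
  have h4 : exp (A ^ 2 + B ^ 2) * exp (A ^ 2 + B ^ 2) = exp (2 * A ^ 2) * exp (2 * B ^ 2) := by
    rw [← exp_add, ← exp_add]; ring_nf
  calc ((ρ * A) ^ 2 + (ρ * B) ^ 2) ^ 2 * exp (γ * ((ρ * A) ^ 2 + (ρ * B) ^ 2))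
      = ρ ^ 4 * ((A ^ 2 + B ^ 2) ^ 2 * exp (γ * ((ρ * A) ^ 2 + (ρ * B) ^ 2))) := by ring
    _ ≤ ρ ^ 4 * (2 * exp (A ^ 2 + B ^ 2) * exp (A ^ 2 + B ^ 2)) := by gcongr
    _ ≤ ρ ^ 4 * (exp (4 * π * A ^ 2) + exp (4 * π * B ^ 2)) := by
      gcongr
      nlinarith [h3 A, h3 B, sq_nonneg (exp (2 * A ^ 2) - exp (2 * B ^ 2))]

/-- Mountain-pass geometry near the origin: under the Moser and Poincaré hypotheses,
`(SL)` and the exponential growth bound, for each `λ > 0` there exist `ρ₀, τ₀ > 0` with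
`J_λ(W) ≥ τ₀` whenever `‖W‖ = ρ₀`. -/
theorem stmt_7 (Ω : Set (ℝ × ℝ)) (hne : Ω.Nonempty) (hop : IsOpen Ω)
    (hbd : Bornology.IsBounded Ω)
    (a₁ a₂ b₁ b₂ θ₁ θ₂ : ℝ)
    (ha₁ : 0 < a₁) (ha₂ : 0 < a₂) (hb₁ : 0 < b₁) (hb₂ : 0 < b₂)
    (hθ₁ : 1 < θ₁) (hθ₂ : 1 < θ₂)
    (CΩ : ℝ) (hCΩ : 0 < CΩ)
    (moser : ∀ u : (ℝ × ℝ) → ℝ, IsTest Ω u → gnorm Ω u ≤ 1 →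
      ∫ x in Ω, Real.exp (4 * Real.pi * (u x) ^ 2) ≤ CΩ)
    (lam1 : ℝ) (hlam1 : 0 < lam1)
    (poincare : ∀ u v : (ℝ × ℝ) → ℝ, IsTest Ω u → IsTest Ω v →
      lam1 * ∫ x in Ω, ((u x) ^ 2 + (v x) ^ 2) ≤ (pnorm Ω u v) ^ 2)
    (H : (ℝ × ℝ) → (ℝ × ℝ) → ℝ)
    (hHc : ContinuousOn (fun p : (ℝ × ℝ) × (ℝ × ℝ) => H p.1 p.2) (closure Ω ×ˢ Set.univ))
    (hHnn : ∀ x ∈ closure Ω, ∀ W : ℝ × ℝ, 0 ≤ H x W)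
    -- (SL)
    (hSL : ∀ δ > (0 : ℝ), ∃ r > (0 : ℝ), ∀ x ∈ closure Ω, ∀ W : ℝ × ℝ,
      Real.sqrt (W.1 ^ 2 + W.2 ^ 2) < r → H x W ≤ δ * (W.1 ^ 2 + W.2 ^ 2))
    -- growth condition
    (β q C₀ : ℝ) (hβ : 0 < β) (hq : 2 < q) (hC₀ : 0 < C₀)
    (hgrowth : ∀ x ∈ closure Ω, ∀ W : ℝ × ℝ, 1 ≤ Real.sqrt (W.1 ^ 2 + W.2 ^ 2) →
      H x W ≤ C₀ * (Real.sqrt (W.1 ^ 2 + W.2 ^ 2)) ^ q * Real.exp (β * (W.1 ^ 2 + W.2 ^ 2)))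
    (lam : ℝ) (hlam : 0 < lam) :
    ∃ ρ₀ > (0 : ℝ), ∃ τ₀ > (0 : ℝ), ∀ u v : (ℝ × ℝ) → ℝ, IsTest Ω u → IsTest Ω v →
      pnorm Ω u v = ρ₀ → τ₀ ≤ Jfun Ω a₁ a₂ b₁ b₂ θ₁ θ₂ lam H u v := by
  have hK : IsCompact (closure Ω) := hbd.isCompact_closure
  have hint : ∀ f : (ℝ × ℝ) → ℝ, Continuous f → IntegrableOn f Ω := fun f hf =>
    (hf.continuousOn.integrableOn_compact hK).mono_set subset_closure
  set a := min a₁ a₂ with ha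
  have ha0 : 0 < a := lt_min ha₁ ha₂
  have hδ : 0 < a * lam1 / (8 * lam) := by positivity
  obtain ⟨r, hr, hsmall⟩ := hSL _ hδ
  obtain ⟨C, hC, hH⟩ :=
    exists_le_quadratic_add_exp hK hHc hδ.le hr hsmall hβ hC₀ hgrowth
  set m := min (1 / (β + 1)) (a / (16 * lam * C * CΩ)) with hm
  have hm0 : 0 < m := by positivity
  refine ⟨√m, sqrt_pos.2 hm0, a / 4 * m, by positivity, fun u v hu hv hρ => ?_⟩
  have hρ0 : 0 < √m := sqrt_pos.2 hm0
  have hρ2 : √m ^ 2 = m := sq_sqrt hm0.le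
  have hsum : gnorm Ω u ^ 2 + gnorm Ω v ^ 2 = m := by rw [← pnorm_sq, hρ, hρ2]
  have hγ : (β + 1) * √m ^ 2 ≤ 1 := by
    rw [hρ2]
    exact (le_div_iff₀' (by positivity)).1 (min_le_left _ _)
  have hmu := integral_exp_div_le moser hu hρ0
    (le_sqrt_of_sq_le (by nlinarith [sq_nonneg (gnorm Ω v)]))
  have hmv := integral_exp_div_le moser hv hρ0
    (le_sqrt_of_sq_le (by nlinarith [sq_nonneg (gnorm Ω u)]))
  have hcu := hu.1.continuous
  have hcv := hv.1.continuous
  have hpoin : ∫ x in Ω, ((u x) ^ 2 + (v x) ^ 2) ≤ m / lam1 := by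
    have := poincare u v hu hv
    rw [hρ, hρ2] at this
    rwa [le_div_iff₀' hlam1]
  have hIs := hint (fun x => (u x) ^ 2 + (v x) ^ 2) (by fun_prop)
  have hIu := hint (fun x => exp (4 * π * (u x / √m) ^ 2)) (by fun_prop)
  have hIv := hint (fun x => exp (4 * π * (v x / √m) ^ 2)) (by fun_prop)
  have hHint : ∫ x in Ω, H x (u x, v x) ≤
      a * lam1 / (8 * lam) * (m / lam1) + C * (m ^ 2 * (CΩ + CΩ)) := by
    calc ∫ x in Ω, H x (u x, v x)
        ≤ ∫ x in Ω, (a * lam1 / (8 * lam) * ((u x) ^ 2 + (v x) ^ 2) + C * (√m ^ 4 *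
            (exp (4 * π * (u x / √m) ^ 2) + exp (4 * π * (v x / √m) ^ 2)))) := by
          apply integral_mono_of_nonneg
          · filter_upwards [ae_restrict_mem hop.measurableSet] with x hx
            exact hHnn x (subset_closure hx) _
          · exact (hIs.const_mul _).add (((hIu.add hIv).const_mul _).const_mul _)
          · filter_upwards [ae_restrict_mem hop.measurableSet] with x hx
            exact (hH x (subset_closure hx) (u x, v x)).trans
              (add_le_add_right (mul_le_mul_of_nonneg_left (sq_mul_exp_le hρ0 hγ) hC.le) _)
      _ = a * lam1 / (8 * lam) * (∫ x in Ω, ((u x) ^ 2 + (v x) ^ 2)) + C * (m ^ 2 *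
            ((∫ x in Ω, exp (4 * π * (u x / √m) ^ 2))
              + ∫ x in Ω, exp (4 * π * (v x / √m) ^ 2))) := by
          have hIuv : IntegrableOn (fun x =>
              exp (4 * π * (u x / √m) ^ 2) + exp (4 * π * (v x / √m) ^ 2)) Ω := hIu.add hIv
          rw [integral_add (hIs.const_mul _) ((hIuv.const_mul _).const_mul _),
            integral_const_mul, integral_const_mul, integral_const_mul, integral_add hIu hIv,
            show √m ^ 4 = m ^ 2 by rw [← hρ2, ← pow_mul, hρ2]]
      _ ≤ _ := by gcongr
  have hmul : lam * ∫ x in Ω, H x (u x, v x) ≤ a / 8 * m + a / 8 * m := by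
    refine (mul_le_mul_of_nonneg_left hHint hlam.le).trans ?_
    have h16 : m * (16 * lam * C * CΩ) ≤ a :=
      (le_div_iff₀ (by positivity)).1 (min_le_right _ _)
    have h8 : lam * (a * lam1 / (8 * lam) * (m / lam1)) = a / 8 * m := by field_simp
    rw [mul_add, h8]
    nlinarith
  have hkin : a * m ≤ a₁ * gnorm Ω u ^ 2 + a₂ * gnorm Ω v ^ 2 := by
    rw [← hsum, mul_add]
    gcongr
    exacts [min_le_left _ _, min_le_right _ _]
  have hbu : 0 ≤ b₁ / θ₁ * gnorm Ω u ^ (2 * θ₁) :=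
    mul_nonneg (by positivity) (rpow_nonneg (gnorm_nonneg Ω u) _)
  have hbv : 0 ≤ b₂ / θ₂ * gnorm Ω v ^ (2 * θ₂) :=
    mul_nonneg (by positivity) (rpow_nonneg (gnorm_nonneg Ω v) _)
  unfold Jfun
  linarith
end
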